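/- Let S be a round sphere in ℝ³ and let C_1, ..., C_k be round circles contained in S, i.e. each C_i = S ∩ P_i where P_i is a 2-dimensional affine subspace of ℝ³ whose distance from the center of S is strictly less than the radius of S. Then the complement S \ (C_1 ∪ ... ∪ C_k), as a topological subspace, has at most k² − k + 2 connected components. -/

import Mathlib

open Metric
open Topology Set

lemma rank_lc_le_of_surj {X Y : Type} [TopologicalSpace X] [TopologicalSpace Y] (f : X → Y)
    (hf : Continuous f) (hs : Function.Surjective f) :
    Module.rank ℝ (LocallyConstant Y ℝ) ≤ Module.rank ℝ (LocallyConstant X ℝ) := by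
  refine LinearMap.rank_le_of_injective (LocallyConstant.comapₗ ℝ ⟨f, hf⟩) ?_
  intro a b hab
  ext y
  obtain ⟨x, rfl⟩ := hs y
  exact congrArg (fun (l : LocallyConstant X ℝ) => l x) hab

lemma rank_lc_le_one {X : Type} [TopologicalSpace X] [PreconnectedSpace X] :
    Module.rank ℝ (LocallyConstant X ℝ) ≤ 1 := by
  rcases isEmpty_or_nonempty X with h | ⟨⟨x0⟩⟩
  · have : Subsingleton (LocallyConstant X ℝ) := ⟨fun a b => by ext x; exact h.elim x⟩
    simp
  · have := LinearMap.rank_le_of_injective (LocallyConstant.evalₗ ℝ x0 : LocallyConstant X ℝ →ₗ[ℝ] ℝ) ?_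
    · simpa using this
    · intro a b hab
      ext x
      rw [a.apply_eq_of_preconnectedSpace x x0, b.apply_eq_of_preconnectedSpace x x0]
      exact hab

lemma card_cc_le {X : Type} [TopologicalSpace X] [LocallyConnectedSpace X] :
    Cardinal.mk (ConnectedComponents X) ≤ Module.rank ℝ (LocallyConstant X ℝ) := by
  rw [← rank_finsupp_self' (R := ℝ) (ι := ConnectedComponents X)]
  let T : (ConnectedComponents X →₀ ℝ) →ₗ[ℝ] LocallyConstant X ℝ :=
    { toFun := fun f => ⟨fun x => f (ConnectedComponents.mk x),
        (IsLocallyConstant.of_discrete f).comp_continuous ConnectedComponents.continuous_coe⟩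
      map_add' := fun f g => by ext x; simp
      map_smul' := fun f g => by ext x; simp }
  refine LinearMap.rank_le_of_injective T ?_
  intro a b hab
  ext y
  obtain ⟨x, rfl⟩ := ConnectedComponents.surjective_coe y
  exact congrArg (fun (l : LocallyConstant X ℝ) => l x) hab

/-- two-sidedness -/
def TwoSided {X : Type} [TopologicalSpace X] (g : X → ℝ) : Prop :=
  ∀ z, g z = 0 → ∀ V ∈ 𝓝 z, ∃ W ∈ 𝓝 z, W ⊆ V ∧ IsConnected (W ∩ {x | 0 < g x}) ∧
    IsConnected (W ∩ {x | g x < 0})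

lemma lc_const {X : Type} [TopologicalSpace X] {g : X → ℝ}
    (f : LocallyConstant {x // g x ≠ 0} ℝ) {s : Set X} (hs : IsPreconnected s)
    {x y : {x // g x ≠ 0}} (hsub : ∀ x ∈ s, g x ≠ 0) (hx : (x : X) ∈ s) (hy : (y : X) ∈ s) :
    f x = f y := by
  have : IsPreconnected ((↑) ⁻¹' s : Set {x // g x ≠ 0}) := by
    refine (IsInducing.subtypeVal (t := {x | g x ≠ 0})).isPreconnected_image.1 ?_
    convert hs using 1
    ext t; constructor
    · rintro ⟨x, hx, rfl⟩
      exact hx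
    · exact fun h => ⟨⟨t, hsub t h⟩, h, rfl⟩
  exact f.isLocallyConstant.apply_eq_of_isPreconnected this hx hy

lemma jump {X : Type} [TopologicalSpace X] (g : X → ℝ) (hg : Continuous g) (H : TwoSided g) :
    Module.rank ℝ (LocallyConstant {x // g x ≠ 0} ℝ) ≤
      Module.rank ℝ (LocallyConstant X ℝ) + Module.rank ℝ (LocallyConstant {x // g x = 0} ℝ) := by
  have H1 : ∀ z : {x // g x = 0}, ∃ W ∈ 𝓝 (z : X), IsConnected (W ∩ {x | 0 < g x}) ∧
    IsConnected (W ∩ {x | g x < 0}) := fun z => by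
      obtain ⟨W, h1, _, h2⟩ := H z z.2 univ Filter.univ_mem
      exact ⟨W, h1, h2⟩
  choose W hW hp hn using H1
  choose p hpW using fun z => (hp z).nonempty
  choose q hqW using fun z => (hn z).nonempty
  let p' : {x // g x = 0} → {x // g x ≠ 0} := fun z => ⟨p z, ne_of_gt (hpW z).2⟩
  let q' : {x // g x = 0} → {x // g x ≠ 0} := fun z => ⟨q z, ne_of_lt (hqW z).2⟩
  have hfp : ∀ (f : LocallyConstant {x // g x ≠ 0} ℝ) (z) (x : {x // g x ≠ 0}),
      (x : X) ∈ W z → 0 < g x → f x = f (p' z) := fun f z x h1 h2 =>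
    lc_const f (hp z).isPreconnected (fun x hx => ne_of_gt hx.2) ⟨h1, h2⟩ (hpW z)
  have hfq : ∀ (f : LocallyConstant {x // g x ≠ 0} ℝ) (z) (x : {x // g x ≠ 0}),
      (x : X) ∈ W z → g x < 0 → f x = f (q' z) := fun f z x h1 h2 =>
    lc_const f (hn z).isPreconnected (fun x hx => ne_of_lt hx.2) ⟨h1, h2⟩ (hqW z)
  have hzp : ∀ (f : LocallyConstant {x // g x ≠ 0} ℝ) (z z' : {x // g x = 0}),
      (z' : X) ∈ interior (W z) → f (p' z') = f (p' z) ∧ f (q' z') = f (q' z) := by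
    intro f z z' h
    obtain ⟨V, hV, hsub, h1, h2⟩ := H z' z'.2 (W z ∩ W z')
      (Filter.inter_mem (mem_interior_iff_mem_nhds.1 h) (hW z'))
    obtain ⟨x, hx⟩ := h1.nonempty
    obtain ⟨y, hy⟩ := h2.nonempty
    constructor
    · rw [← hfp f z ⟨x, ne_of_gt hx.2⟩ (hsub hx.1).1 hx.2, ← hfp f z' ⟨x, ne_of_gt hx.2⟩ (hsub hx.1).2 hx.2]
    · rw [← hfq f z ⟨y, ne_of_lt hy.2⟩ (hsub hy.1).1 hy.2, ← hfq f z' ⟨y, ne_of_lt hy.2⟩ (hsub hy.1).2 hy.2]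
  let J : LocallyConstant {x // g x ≠ 0} ℝ →ₗ[ℝ] LocallyConstant {x // g x = 0} ℝ :=
    { toFun := fun f => ⟨fun z => f (p' z) - f (q' z), by
        rw [IsLocallyConstant.iff_eventually_eq]
        intro z
        have : ∀ᶠ z' : {x // g x = 0} in 𝓝 z, (z' : X) ∈ interior (W z) :=
          continuous_subtype_val.continuousAt.eventually
            (isOpen_interior.mem_nhds (mem_interior_iff_mem_nhds.2 (hW z)))
        filter_upwards [this] with z' hz'
        rw [(hzp f z z' hz').1, (hzp f z z' hz').2]⟩
      map_add' := fun f g => by ext x; simp; ring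
      map_smul' := fun f g => by ext x; simp; ring }
  let r : LocallyConstant X ℝ →ₗ[ℝ] LocallyConstant {x // g x ≠ 0} ℝ :=
    LocallyConstant.comapₗ ℝ ⟨Subtype.val, continuous_subtype_val⟩
  have hker : LinearMap.ker J ≤ LinearMap.range r := by
    intro f hf
    have hf' : ∀ z, f (p' z) = f (q' z) := fun z => by
      have := congrArg (fun (l : LocallyConstant {x // g x = 0} ℝ) => l z) (LinearMap.mem_ker.1 hf)
      exact sub_eq_zero.1 this
    let F : X → ℝ := fun x => if h : g x = 0 then f (p' ⟨x, h⟩) else f ⟨x, h⟩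
    have hF : IsLocallyConstant F := by
      rw [IsLocallyConstant.iff_eventually_eq]
      intro x
      by_cases hx : g x = 0
      · filter_upwards [isOpen_interior.mem_nhds (mem_interior_iff_mem_nhds.2 (hW ⟨x, hx⟩))] with y hy
        have hy' := interior_subset hy
        have e : F x = f (p' ⟨x, hx⟩) := by simp [F, hx]
        rw [e]
        by_cases h : g y = 0
        · simp only [F, h, dif_pos]
          exact (hzp f ⟨x, hx⟩ ⟨y, h⟩ hy).1
        · simp only [F, h, dif_neg, not_false_eq_true]
          rcases lt_or_gt_of_ne h with h2 | h2
          · rw [hf']; exact hfq f ⟨x, hx⟩ ⟨y, h⟩ hy' h2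
          · exact hfp f ⟨x, hx⟩ ⟨y, h⟩ hy' h2
      · have ho : IsOpen {x | g x ≠ 0} := isOpen_ne_fun hg continuous_const
        have h1 := (IsLocallyConstant.iff_eventually_eq _).1 f.isLocallyConstant ⟨x, hx⟩
        rw [nhds_subtype_eq_comap, Filter.eventually_comap] at h1
        filter_upwards [h1, ho.mem_nhds hx] with y hy hy2
        have hy2 : ¬ g y = 0 := hy2
        simp only [F, hx, hy2, dif_neg, not_false_eq_true]
        exact hy ⟨y, hy2⟩ rfl
    refine ⟨⟨F, hF⟩, ?_⟩
    ext x
    change F x = f x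
    have := x.2
    simp only [F, this, dif_neg, not_false_eq_true, Subtype.coe_eta]
  rw [← LinearMap.rank_range_add_rank_ker J, add_comm]
  exact add_le_add ((Submodule.rank_mono hker).trans (rank_range_le r)) (Submodule.rank_le _)

lemma line_aux (a b : ℝ) (F : Finset ℝ) :
    Module.rank ℝ (LocallyConstant ↥(Ioo a b \ (F : Set ℝ)) ℝ) ≤ (F.card : Cardinal) + 1 := by
  classical
  induction F using Finset.induction_on with
  | empty =>
    have : PreconnectedSpace ↥(Ioo a b \ ((∅ : Finset ℝ) : Set ℝ)) := by
      apply Subtype.preconnectedSpace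
      simpa using (isPreconnected_Ioo (a := a) (b := b))
    simpa using rank_lc_le_one (X := ↥(Ioo a b \ ((∅ : Finset ℝ) : Set ℝ)))
  | insert t F ht ih =>
    let g : ↥(Ioo a b \ (F : Set ℝ)) → ℝ := fun x => x - t
    have hg : Continuous g := by fun_prop
    have hopen : IsOpen (Ioo a b \ (F : Set ℝ)) := isOpen_Ioo.sdiff F.finite_toSet.isClosed
    have H : TwoSided g := by
      intro z hz V hV
      have hzt : (z : ℝ) = t := sub_eq_zero.1 hz
      have hV' := (hopen.isOpenEmbedding_subtypeVal.image_mem_nhds).2 hV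
      obtain ⟨l, u, hl, hsub⟩ := mem_nhds_iff_exists_Ioo_subset.1 hV'
      have hsubU : Ioo l u ⊆ Ioo a b \ (F : Set ℝ) := hsub.trans (by rintro _ ⟨x, _, rfl⟩; exact x.2)
      refine ⟨(↑) ⁻¹' Ioo l u, continuous_subtype_val.continuousAt.preimage_mem_nhds (Ioo_mem_nhds hl.1 hl.2), ?_, ?_, ?_⟩
      · intro x hx
        obtain ⟨y, hy, hyx⟩ := hsub hx
        rwa [← Subtype.ext hyx]
      · have e : Subtype.val '' ((↑) ⁻¹' Ioo l u ∩ {x : ↥(Ioo a b \ (F : Set ℝ)) | 0 < g x}) = Ioo t u := by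
          ext y; constructor
          · rintro ⟨x, ⟨hx1, hx2⟩, rfl⟩
            exact ⟨sub_pos.1 hx2, hx1.2⟩
          · intro hy
            have : y ∈ Ioo l u := ⟨(hzt ▸ hl.1).trans hy.1, hy.2⟩
            exact ⟨⟨y, hsubU this⟩, ⟨this, sub_pos.2 hy.1⟩, rfl⟩
        have hc : IsConnected (Ioo t u) := isConnected_Ioo (hzt ▸ hl.2)
        rw [← e] at hc
        exact ⟨hc.nonempty.of_image, IsInducing.subtypeVal.isPreconnected_image.1 hc.isPreconnected⟩
      · have e : Subtype.val '' ((↑) ⁻¹' Ioo l u ∩ {x : ↥(Ioo a b \ (F : Set ℝ)) | g x < 0}) = Ioo l t := by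
          ext y; constructor
          · rintro ⟨x, ⟨hx1, hx2⟩, rfl⟩
            exact ⟨hx1.1, sub_neg.1 hx2⟩
          · intro hy
            have : y ∈ Ioo l u := ⟨hy.1, hy.2.trans (hzt ▸ hl.2)⟩
            exact ⟨⟨y, hsubU this⟩, ⟨this, sub_neg.2 hy.2⟩, rfl⟩
        have hc : IsConnected (Ioo l t) := isConnected_Ioo (hzt ▸ hl.1)
        rw [← e] at hc
        exact ⟨hc.nonempty.of_image, IsInducing.subtypeVal.isPreconnected_image.1 hc.isPreconnected⟩
    have h1 := jump g hg H
    have h2 : Module.rank ℝ (LocallyConstant {x // g x = 0} ℝ) ≤ 1 := by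
      have : Subsingleton {x // g x = 0} := ⟨fun x y => by
        have hx := sub_eq_zero.1 x.2
        have hy := sub_eq_zero.1 y.2
        exact Subtype.ext (Subtype.ext (hx.trans hy.symm))⟩
      exact rank_lc_le_one
    rw [Finset.card_insert_of_notMem ht]
    have h3 : Module.rank ℝ (LocallyConstant ↥(Ioo a b \ ((insert t F : Finset ℝ) : Set ℝ)) ℝ) ≤
        Module.rank ℝ (LocallyConstant {x // g x ≠ 0} ℝ) := by
      refine rank_lc_le_of_surj (fun x : {x // g x ≠ 0} => ⟨(x.1 : ℝ), x.1.2.1, ?_⟩) (by fun_prop) ?_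
      · intro h
        rcases Finset.mem_insert.1 h with h | h
        · exact x.2 (sub_eq_zero.2 h)
        · exact x.1.2.2 h
      · rintro ⟨y, hy, hy2⟩
        refine ⟨⟨⟨y, hy, fun h => hy2 (by simp at h ⊢; exact Or.inr h)⟩, fun h => hy2 ?_⟩, rfl⟩
        have := sub_eq_zero.1 h
        simp only at this
        simp [this]
    refine (h3.trans h1).trans ?_
    push_cast
    exact add_le_add ih h2
abbrev E3 := EuclideanSpace ℝ (Fin 3)

lemma coords (c : E3) (R : ℝ) (P : AffineSubspace ℝ E3)
    (hdim : Module.finrank ℝ P.direction = 2)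
    (hdist : Metric.infDist c (P : Set E3) < R) :
    ∃ (L : E3 ≃ₜ ℝ × ℂ) (h0 : ℝ), |h0| < R ∧ (∀ x, x ∈ P ↔ (L x).1 = h0) ∧
      ∀ x, dist x c ^ 2 = (L x).1 ^ 2 + ‖(L x).2‖ ^ 2 := by
  have hne : (P : Set E3).Nonempty := by
    rw [AffineSubspace.nonempty_iff_ne_bot]
    rintro rfl
    rw [AffineSubspace.direction_bot, finrank_bot] at hdim
    omega
  obtain ⟨q, hq, hqd⟩ := (Metric.infDist_lt_iff hne).1 hdist
  have hE : Module.finrank ℝ E3 = 3 := by simp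
  have hperp : Module.finrank ℝ P.directionᗮ = 1 := by
    have := P.direction.finrank_add_finrank_orthogonal
    omega
  obtain ⟨n', hn'⟩  := Module.finrank_pos_iff_exists_ne_zero.1 (by omega : 0 < Module.finrank ℝ P.directionᗮ)
  have hn0 : (n' : E3) ≠ 0 := by simpa using hn'
  obtain ⟨n, hn, hnorm⟩ : ∃ n : E3, n ∈ P.directionᗮ ∧ ‖n‖ = 1 :=
    ⟨(‖(n' : E3)‖⁻¹ : ℝ) • (n' : E3), Submodule.smul_mem _ _ n'.2, by
      rw [norm_smul, norm_inv, norm_norm, inv_mul_cancel₀ (norm_ne_zero_iff.2 hn0)]⟩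
  have hnne : n ≠ 0 := by intro h; simp [h] at hnorm
  have hdir : P.direction = (ℝ ∙ n)ᗮ := by
    refine Submodule.eq_of_le_of_finrank_eq ?_ ?_
    · rw [← Submodule.le_orthogonal_iff_le_orthogonal, Submodule.span_singleton_le_iff_mem]
      exact hn
    · have h1 := (ℝ ∙ n).finrank_add_finrank_orthogonal
      have h2 := finrank_span_singleton (K := ℝ) hnne
      omega
  obtain ⟨b, hb⟩ := Orthonormal.exists_orthonormalBasis_extension_of_card_eq (𝕜 := ℝ) (E := E3)
    (ι := Fin 3) (by simp) (v := fun _ => n) (s := {0}) (by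
      constructor
      · intro i; exact hnorm
      · intro i j hij
        exact absurd (Subsingleton.elim i j) hij)
  have hb0 : b 0 = n := hb 0 rfl
  let L : E3 ≃ₜ ℝ × ℂ :=
    { toFun := fun x => (b.repr (x - c) 0, ⟨b.repr (x - c) 1, b.repr (x - c) 2⟩)
      invFun := fun y => b.repr.symm (!₂[y.1, y.2.re, y.2.im]) + c
      left_inv := fun x => by
        have : !₂[b.repr (x - c) 0, b.repr (x - c) 1, b.repr (x - c) 2] = b.repr (x - c) := by
          ext i; fin_cases i <;> rfl
        simp only [this]
        simp
      right_inv := fun y => by simp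
      continuous_toFun := by
        have h : Continuous fun x : E3 => b.repr (x - c) :=
          b.repr.continuous.comp (by fun_prop)
        have hi : ∀ i, Continuous fun x : E3 => b.repr (x - c) i := fun i => by fun_prop
        have := (hi 1).prodMk (hi 2)
        exact (hi 0).prodMk (Complex.equivRealProdCLM.symm.continuous.comp this)
      continuous_invFun := by
        refine (b.repr.symm.continuous.comp ?_).add continuous_const
        refine (PiLp.continuous_toLp 2 _).comp ?_
        refine continuous_pi fun i => ?_
        fin_cases i <;> simp <;> fun_prop }
  have hL1 : ∀ x, (L x).1 = b.repr (x - c) 0 := fun x => rfl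
  refine ⟨L, (L q).1, ?_, ?_, ?_⟩
  · rw [hL1]
    have h1 : ‖b.repr (q - c) 0‖ ≤ ‖b.repr (q - c)‖ := PiLp.norm_apply_le _ _
    rw [LinearIsometryEquiv.norm_map, ← dist_eq_norm, dist_comm] at h1
    exact lt_of_le_of_lt h1 hqd
  · intro x
    have h1 : x ∈ P ↔ x - q ∈ P.direction := by
      constructor
      · exact fun h => AffineSubspace.vsub_mem_direction h hq
      · intro h
        have := AffineSubspace.vadd_mem_of_mem_direction h hq
        simpa using this
    rw [h1, hdir, Submodule.mem_orthogonal_singleton_iff_inner_right, hL1, hL1,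
      b.repr_apply_apply, b.repr_apply_apply, hb0, ← sub_eq_zero (b := inner ℝ n (q - c)), ← inner_sub_right]
    simp
  · intro x
    rw [dist_eq_norm, ← LinearIsometryEquiv.norm_map b.repr, EuclideanSpace.norm_sq_eq, Fin.sum_univ_three,
      Complex.sq_norm, Complex.normSq_apply, hL1]
    have h1 : (L x).2.re = b.repr (x - c) 1 := rfl
    have h2 : (L x).2.im = b.repr (x - c) 2 := rfl
    rw [h1, h2]
    simp only [Real.norm_eq_abs, sq_abs]
    ring

lemma lcs_sphere (c : E3) (R : ℝ) (hR : 0 < R) : LocallyConnectedSpace (sphere c R) := by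
  have : Fact (Module.finrank ℝ E3 = 2 + 1) := ⟨by simp⟩
  have : LocallyConnectedSpace (sphere (0 : E3) 1) :=
    ChartedSpace.locallyConnectedSpace (EuclideanSpace ℝ (Fin 2)) _
  let e : sphere c R ≃ₜ sphere (0 : E3) 1 :=
    { toFun := fun x => ⟨R⁻¹ • (x - c), by
        have := x.2
        simp only [mem_sphere_iff_norm] at this
        simp [norm_smul, this, abs_of_pos hR, hR.ne']⟩
      invFun := fun y => ⟨R • (y : E3) + c, by
        simp [norm_smul, abs_of_pos hR]⟩
      left_inv := fun x => by ext; simp [hR.ne']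
      right_inv := fun x => by ext; simp [hR.ne']
      continuous_toFun := by fun_prop
      continuous_invFun := by fun_prop }
  exact e.locallyConnectedSpace

lemma two_pts (c : E3) (R : ℝ) (P Q : AffineSubspace ℝ E3)
    (hP : Module.finrank ℝ P.direction = 2) (hQ : Module.finrank ℝ Q.direction = 2) (hne : P ≠ Q) :
    (sphere c R ∩ P ∩ Q : Set E3).encard ≤ 2 := by
  by_contra! h
  obtain ⟨t, hts, ht⟩ := Set.exists_subset_encard_eq (k := 3)
    (by have := Order.add_one_le_of_lt h; rwa [two_add_one_eq_three] at this : (3 : ℕ∞) ≤ (sphere c R ∩ P ∩ Q : Set E3).encard)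
  obtain ⟨x, y, z, hxy, hxz, hyz, rfl⟩ := Set.encard_eq_three.1 ht
  have hx := hts (by simp : x ∈ ({x, y, z} : Set E3))
  have hy := hts (by simp : y ∈ ({x, y, z} : Set E3))
  have hz := hts (by simp : z ∈ ({x, y, z} : Set E3))
  have hcs : EuclideanGeometry.Cospherical ({x, y, z} : Set E3) := by
    refine ⟨c, R, ?_⟩
    rintro p (rfl | rfl | rfl)
    exacts [hx.1.1, hy.1.1, hz.1.1]
  have hi := hcs.affineIndependent_of_ne hxy hxz hyz
  apply hne
  rw [← hi.affineSpan_eq_of_le_of_card_eq_finrank_add_one (sp := P) _ (by simp [hP]),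
    ← hi.affineSpan_eq_of_le_of_card_eq_finrank_add_one (sp := Q) _ (by simp [hQ])]
  · rw [affineSpan_le]
    rintro _ ⟨i, rfl⟩
    fin_cases i
    exacts [hx.2, hy.2, hz.2]
  · rw [affineSpan_le]
    rintro _ ⟨i, rfl⟩
    fin_cases i
    exacts [hx.1.2, hy.1.2, hz.1.2]

lemma exp_per : Function.Periodic (fun θ : ℝ => Complex.exp (θ * Complex.I)) (2 * Real.pi) := by
  intro θ
  have := Complex.exp_mul_I_periodic (θ : ℂ)
  simpa using this

lemma exp_inj (a x y : ℝ) (hx : x ∈ Ico a (a + 2 * Real.pi)) (hy : y ∈ Ico a (a + 2 * Real.pi))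
    (h : Complex.exp (x * Complex.I) = Complex.exp (y * Complex.I)) : x = y := by
  obtain ⟨n, hn⟩ := Complex.exp_eq_exp_iff_exists_int.1 h
  have h1 : (x : ℂ) = ((y + n * (2 * Real.pi) : ℝ) : ℂ) := by
    apply mul_right_cancel₀ Complex.I_ne_zero
    rw [hn]; push_cast; ring
  have h2 : x = y + n * (2 * Real.pi) := by exact_mod_cast h1
  have hp := Real.two_pi_pos
  have h3 : n = 0 := by
    have l1 : (n : ℝ) < 1 := by
      by_contra! hc
      nlinarith [hx.2, hy.1]
    have l2 : (-1 : ℝ) < n := by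
      by_contra! hc
      nlinarith [hx.1, hy.2]
    have l1' : n < 1 := by exact_mod_cast l1
    have l2' : -1 < n := by exact_mod_cast l2
    omega
  simpa [h3] using h2

lemma circle_aux (C F : Set E3) (L : E3 ≃ₜ ℝ × ℂ) (h0 ρ : ℝ) (hρ : 0 < ρ)
    (hC : ∀ x, x ∈ C ↔ (L x).1 = h0 ∧ ‖(L x).2‖ = ρ) (hF : F ⊆ C) (hfin : F.Finite) (m : ℕ)
    (hm : F.ncard ≤ m) :
    Module.rank ℝ (LocallyConstant ↥(C \ F) ℝ) ≤ ((max 1 m : ℕ) : Cardinal) := by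
  let γ : ℝ → E3 := fun θ => L.symm (h0, ρ * Complex.exp (θ * Complex.I))
  have hγ : Continuous γ := by
    refine L.symm.continuous.comp ?_
    fun_prop
  have hγC : ∀ θ, γ θ ∈ C := fun θ => by
    rw [hC]; simp [γ, Complex.norm_exp_ofReal_mul_I, abs_of_pos hρ]
  have hsurj : ∀ a x, x ∈ C → ∃ θ ∈ Ico a (a + 2 * Real.pi), γ θ = x := by
    intro a x hx
    rw [hC] at hx
    obtain ⟨y, hy, hxy⟩ := exp_per.exists_mem_Ico Real.two_pi_pos (Complex.arg (L x).2) a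
    refine ⟨y, hy, ?_⟩
    simp only [γ]
    rw [← hxy, ← hx.2, Complex.norm_mul_exp_arg_mul_I, ← hx.1]
    simp
  have hinj : ∀ a, InjOn γ (Ico a (a + 2 * Real.pi)) := by
    intro a x hx y hy hxy
    have h1 := L.symm.injective hxy
    have h2 := mul_left_cancel₀ (by exact_mod_cast hρ.ne') (Prod.ext_iff.1 h1).2
    exact exp_inj a x y hx hy h2
  rcases F.eq_empty_or_nonempty with rfl | ⟨p, hp⟩
  · have : Module.rank ℝ (LocallyConstant ↥(C \ ∅) ℝ) ≤ Module.rank ℝ (LocallyConstant ℝ ℝ) := by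
      refine rank_lc_le_of_surj (fun θ => ⟨γ θ, hγC θ, fun h => h⟩) (by fun_prop) ?_
      rintro ⟨x, hx, _⟩
      obtain ⟨θ, _, h⟩ := hsurj 0 x hx
      exact ⟨θ, Subtype.ext h⟩
    refine (this.trans rank_lc_le_one).trans ?_
    exact_mod_cast le_max_left 1 m
  · obtain ⟨a, -, rfl⟩ := hsurj 0 p (hF hp)
    have ha : a ∈ Ico a (a + 2 * Real.pi) := ⟨le_rfl, by linarith [Real.two_pi_pos]⟩
    let G : Set ℝ := Ioo a (a + 2 * Real.pi) ∩ γ ⁻¹' F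
    have hmaps : MapsTo γ G (F \ {γ a}) := by
      intro θ hθ
      refine ⟨hθ.2, fun h => ?_⟩
      have := hinj a (Ioo_subset_Ico_self hθ.1) ha h
      exact absurd hθ.1.1 (by rw [this]; exact lt_irrefl _)
    have hGi : InjOn γ G := (hinj a).mono (fun θ hθ => Ioo_subset_Ico_self hθ.1)
    have hGfin : G.Finite := Set.Finite.of_injOn hmaps hGi (hfin.subset sdiff_subset)
    have hcard : G.ncard + 1 ≤ m := by
      have h1 := Set.ncard_le_ncard_of_injOn γ hmaps hGi (hfin.subset sdiff_subset)
      have h2 := Set.ncard_sdiff_singleton_add_one hp hfin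
      omega
    have h1 := line_aux a (a + 2 * Real.pi) hGfin.toFinset
    rw [← Set.ncard_eq_toFinset_card G hGfin, hGfin.coe_toFinset] at h1
    have h2 : Module.rank ℝ (LocallyConstant ↥(C \ F) ℝ) ≤
        Module.rank ℝ (LocallyConstant ↥(Ioo a (a + 2 * Real.pi) \ G) ℝ) := by
      refine rank_lc_le_of_surj (fun θ => ⟨γ θ, hγC θ, fun h => θ.2.2 ⟨θ.2.1, h⟩⟩) (by fun_prop) ?_
      rintro ⟨x, hx, hxF⟩
      obtain ⟨θ, hθ, rfl⟩ := hsurj a x hx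
      have hne : a ≠ θ := by rintro rfl; exact hxF hp
      exact ⟨⟨θ, ⟨lt_of_le_of_ne hθ.1 hne, hθ.2⟩, fun h => hxF h.2⟩, rfl⟩
    refine (h2.trans h1).trans ?_
    exact_mod_cast hcard.trans (le_max_right 1 m)

lemma two_sided_sphere (c : E3) (R : ℝ) (hR : 0 < R) (K : Set E3) (hK : IsClosed K)
    (L : E3 ≃ₜ ℝ × ℂ) (h0 : ℝ) (hh : |h0| < R)
    (hL : ∀ x, dist x c ^ 2 = (L x).1 ^ 2 + ‖(L x).2‖ ^ 2) :
    TwoSided (fun x : ↥(sphere c R \ K) => (L x).1 - h0) := by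
  intro z hz V hV
  have hz1 : (L z).1 = h0 := sub_eq_zero.1 hz
  obtain ⟨V', hV', hVV⟩ := mem_nhds_subtype _ _ _ |>.1 hV
  let Φ : ℝ × ℝ → E3 := fun y => L.symm (y.1, (Real.sqrt (R ^ 2 - y.1 ^ 2) : ℂ) * Complex.exp (y.2 * Complex.I))
  have hΦ : Continuous Φ := by
    refine L.symm.continuous.comp ?_
    fun_prop
  have hS : ∀ x ∈ sphere c R, Real.sqrt (R ^ 2 - (L x).1 ^ 2) = ‖(L x).2‖ := by
    intro x hx
    have h := hL x
    rw [mem_sphere.1 hx] at h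
    rw [h, add_sub_cancel_left, Real.sqrt_sq (norm_nonneg _)]
  have hΦ1 : ∀ y, (L (Φ y)).1 = y.1 := fun y => by simp [Φ]
  have hΦS : ∀ y : ℝ × ℝ, |y.1| < R → Φ y ∈ sphere c R := by
    intro y hy
    have h := hL (Φ y)
    have hpos : 0 ≤ R ^ 2 - y.1 ^ 2 := by
      have := sq_lt_sq' (abs_lt.1 hy).1 (abs_lt.1 hy).2
      linarith
    have h2 : ‖(L (Φ y)).2‖ = Real.sqrt (R ^ 2 - y.1 ^ 2) := by
      simp [Φ, Complex.norm_exp_ofReal_mul_I, abs_of_nonneg (Real.sqrt_nonneg _)]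
    rw [hΦ1, h2, Real.sq_sqrt hpos, add_sub_cancel] at h
    exact (pow_left_inj₀ dist_nonneg hR.le two_ne_zero).1 h
  let θ0 := Complex.arg (L z).2
  let Ψ : E3 → ℝ × ℝ := fun x => ((L x).1, θ0 + Complex.arg ((L x).2 * Complex.exp (-(θ0 * Complex.I))))
  have hΨΦ : ∀ x ∈ sphere c R, Φ (Ψ x) = x := by
    intro x hx
    simp only [Φ, Ψ]
    rw [hS x hx]
    have h1 := Complex.norm_mul_exp_arg_mul_I ((L x).2 * Complex.exp (-(θ0 * Complex.I)))
    have h2 : ‖Complex.exp (-(θ0 * Complex.I))‖ = 1 := by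
      have := Complex.norm_exp_ofReal_mul_I (-θ0)
      simpa using this
    rw [norm_mul, h2, mul_one] at h1
    have h3 : (‖(L x).2‖ : ℂ) * Complex.exp (((θ0 + Complex.arg ((L x).2 * Complex.exp (-(θ0 * Complex.I))) : ℝ) : ℂ) * Complex.I) = (L x).2 := by
      push_cast
      rw [add_mul, Complex.exp_add, mul_left_comm, h1, mul_left_comm, ← Complex.exp_add]
      simp
    rw [h3]
    simp
  have hzpos : 0 < ‖(L z).2‖ := by
    rw [← hS z z.2.1, hz1]
    apply Real.sqrt_pos.2
    have := sq_lt_sq' (abs_lt.1 hh).1 (abs_lt.1 hh).2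
    linarith
  have hzrot : (L z).2 * Complex.exp (-(θ0 * Complex.I)) = (‖(L z).2‖ : ℂ) := by
    have h1 := Complex.norm_mul_exp_arg_mul_I (L z).2
    conv_lhs => rw [← h1]
    rw [mul_assoc, ← Complex.exp_add]
    simp [θ0]
  have hΨz : Ψ z = (h0, θ0) := by
    simp only [Ψ]
    rw [hzrot, Complex.arg_ofReal_of_nonneg hzpos.le, hz1, add_zero]
  have hΨc : ContinuousAt Ψ z := by
    have hLc := L.continuous
    refine ContinuousAt.prodMk (by fun_prop) (continuousAt_const.add ?_)
    refine ContinuousAt.comp (g := Complex.arg) (Complex.continuousAt_arg ?_) (by fun_prop)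
    rw [hzrot]
    exact Complex.ofReal_mem_slitPlane.2 hzpos
  have hΦz : Φ (h0, θ0) = z := by rw [← hΨz, hΨΦ z z.2.1]
  have hN : Φ ⁻¹' (V' ∩ Kᶜ) ∩ {y | |y.1| < R} ∈ 𝓝 (h0, θ0) := by
    refine Filter.inter_mem (hΦ.continuousAt.preimage_mem_nhds ?_) ?_
    · rw [hΦz]
      exact Filter.inter_mem hV' (hK.isOpen_compl.mem_nhds z.2.2)
    · have : IsOpen {y : ℝ × ℝ | |y.1| < R} := isOpen_lt (by fun_prop) continuous_const
      exact this.mem_nhds hh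
  obtain ⟨ε, hε, hB⟩ := Metric.mem_nhds_iff.1 hN
  rw [← ball_prod_same] at hB
  have key : ∀ T : Set ℝ, IsConnected (ball h0 ε ∩ T) →
      IsConnected (((↑) ⁻¹' (Φ '' (ball h0 ε ×ˢ ball θ0 ε)) : Set ↥(sphere c R \ K)) ∩ {x | (L x).1 ∈ T}) := by
    intro T hT
    have e : Subtype.val '' (((↑) ⁻¹' (Φ '' (ball h0 ε ×ˢ ball θ0 ε)) : Set ↥(sphere c R \ K)) ∩ {x | (L x).1 ∈ T})
        = Φ '' ((ball h0 ε ∩ T) ×ˢ ball θ0 ε) := by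
      ext x
      constructor
      · rintro ⟨x, ⟨⟨y, hy, hyx⟩, hx2⟩, rfl⟩
        refine ⟨y, ⟨⟨hy.1, ?_⟩, hy.2⟩, hyx⟩
        have hx2 : (L x).1 ∈ T := hx2
        rwa [← hyx, hΦ1] at hx2
      · rintro ⟨y, hy, rfl⟩
        have hyB : y ∈ ball h0 ε ×ˢ ball θ0 ε := ⟨hy.1.1, hy.2⟩
        refine ⟨⟨Φ y, hΦS y (hB hyB).2, (hB hyB).1.2⟩, ⟨⟨y, hyB, rfl⟩, ?_⟩, rfl⟩
        change (L (Φ y)).1 ∈ T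
        rw [hΦ1]; exact hy.1.2
    have hθ : IsConnected (ball θ0 ε) := (convex_ball θ0 ε).isConnected ⟨θ0, mem_ball_self hε⟩
    have hc := (hT.prod hθ).image Φ hΦ.continuousOn
    rw [← e] at hc
    exact ⟨hc.nonempty.of_image, IsInducing.subtypeVal.isPreconnected_image.1 hc.isPreconnected⟩
  refine ⟨(↑) ⁻¹' (Φ '' (ball h0 ε ×ˢ ball θ0 ε)), ?_, ?_, ?_, ?_⟩
  · have h1 : ball h0 ε ×ˢ ball θ0 ε ∈ 𝓝 (Ψ z) := by
      rw [hΨz]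
      exact prod_mem_nhds (ball_mem_nhds _ hε) (ball_mem_nhds _ hε)
    have h2 : ContinuousAt (fun x : ↥(sphere c R \ K) => Ψ x) z :=
      ContinuousAt.comp (g := Ψ) hΨc continuous_subtype_val.continuousAt
    filter_upwards [h2.preimage_mem_nhds h1] with x hx
    exact ⟨Ψ x, hx, hΨΦ x x.2.1⟩
  · rintro x ⟨y, hy, hyx⟩
    apply hVV
    change (x : E3) ∈ V'
    rw [← hyx]
    exact (hB hy).1.1
  · have := key (Ioi h0) (by
      rw [Real.ball_eq_Ioo, Ioo_inter_Ioi]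
      apply isConnected_Ioo
      simp [hε]; try linarith)
    simpa [sub_pos] using this
  · have := key (Iio h0) (by
      rw [Real.ball_eq_Ioo, Ioo_inter_Iio]
      apply isConnected_Ioo
      simp [hε]; try linarith)
    simpa [sub_neg] using this

lemma step (c : E3) (R : ℝ) (hR : 0 < R) {k : ℕ} (P : Fin k → AffineSubspace ℝ E3)
    (hdim : ∀ i, Module.finrank ℝ (P i).direction = 2)
    (hdist : ∀ i, Metric.infDist c (P i : Set E3) < R) (s : Finset (Fin k)) (a : Fin k) :
    Module.rank ℝ (LocallyConstant ↥(sphere c R \ ⋃ i ∈ insert a s, (P i : Set E3)) ℝ) ≤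
      Module.rank ℝ (LocallyConstant ↥(sphere c R \ ⋃ i ∈ s, (P i : Set E3)) ℝ) +
        ((max 1 (2 * s.card) : ℕ) : Cardinal) := by
  obtain ⟨L, h0, hh, hP, hL⟩ := coords c R (P a) (hdim a) (hdist a)
  have hK : IsClosed (⋃ i ∈ s, (P i : Set E3)) :=
    s.finite_toSet.isClosed_biUnion fun i _ => (P i).closed_of_finiteDimensional
  have hLc := L.continuous
  have h1 := jump _ (by fun_prop) (two_sided_sphere c R hR _ hK L h0 hh hL)
  refine le_trans (rank_lc_le_of_surj (fun x => ⟨x.1.1, x.1.2.1, ?_⟩) (by fun_prop) ?_) (h1.trans (add_le_add le_rfl ?_))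
  · have h3 := x.1.2.2
    have h4 : x.1.1 ∉ P a := fun h => x.2 (sub_eq_zero.2 ((hP _).1 h))
    simp only [mem_iUnion, Finset.mem_insert] at h3 ⊢
    rintro ⟨i, rfl | hi, hx⟩
    · exact h4 hx
    · exact h3 ⟨i, hi, hx⟩
  · rintro ⟨x, hx, hx2⟩
    simp only [mem_iUnion, Finset.mem_insert] at hx2
    refine ⟨⟨⟨x, hx, ?_⟩, ?_⟩, rfl⟩
    · simp only [mem_iUnion]
      rintro ⟨i, hi, hx⟩
      exact hx2 ⟨i, Or.inr hi, hx⟩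
    · intro h
      exact hx2 ⟨a, Or.inl rfl, (hP x).2 (sub_eq_zero.1 h)⟩
  · set C : Set E3 := sphere c R ∩ P a with hCdef
    have h2 : Module.rank ℝ (LocallyConstant {x : ↥(sphere c R \ ⋃ i ∈ s, (P i : Set E3)) // (L x).1 - h0 = 0} ℝ)
       ≤ Module.rank ℝ (LocallyConstant ↥(C \ (C ∩ ⋃ i ∈ s, (P i : Set E3))) ℝ) := by
      refine rank_lc_le_of_surj (fun x => ⟨⟨x.1, x.2.1.1, fun h => x.2.2 ⟨x.2.1, h⟩⟩,
        sub_eq_zero.2 ((hP _).1 x.2.1.2)⟩)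
        ((continuous_subtype_val.subtype_mk _).subtype_mk _) ?_
      · rintro ⟨⟨x, hx1, hx2⟩, hx3⟩
        exact ⟨⟨x, ⟨hx1, (hP _).2 (sub_eq_zero.1 hx3)⟩, fun h => hx2 h.2⟩, rfl⟩
    refine h2.trans ?_
    by_cases hex : ∃ j ∈ s, P j = P a
    · obtain ⟨j, hj, hja⟩ := hex
      have : IsEmpty ↥(C \ (C ∩ ⋃ i ∈ s, (P i : Set E3))) := ⟨fun x => x.2.2 ⟨x.2.1, by
        simp only [mem_iUnion]
        exact ⟨j, hj, by rw [hja]; exact x.2.1.2⟩⟩⟩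
      refine rank_lc_le_one.trans ?_
      exact_mod_cast le_max_left 1 _
    · push Not at hex
      have hcard : (C ∩ ⋃ i ∈ s, (P i : Set E3)).encard ≤ ((2 * s.card : ℕ) : ℕ∞) := by
        clear h1 h2 hK
        induction s using Finset.induction_on with
        | empty => simp
        | insert j s hj ih =>
          rw [Finset.set_biUnion_insert, inter_union_distrib_left]
          refine (encard_union_le _ _).trans ?_
          rw [Finset.card_insert_of_notMem hj]
          have i1 := two_pts c R (P a) (P j) (hdim a) (hdim j) (hex j (by simp)).symm
          have i2 := ih fun i hi => hex i (by simp [hi])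
          have := add_le_add i1 i2
          refine this.trans (le_of_eq ?_)
          push_cast
          ring
      have hfin : (C ∩ ⋃ i ∈ s, (P i : Set E3)).Finite := finite_of_encard_le_coe hcard
      have hρ : 0 < R ^ 2 - h0 ^ 2 := by
        have := sq_lt_sq' (abs_lt.1 hh).1 (abs_lt.1 hh).2
        linarith
      refine circle_aux C _ L h0 (Real.sqrt (R ^ 2 - h0 ^ 2)) (Real.sqrt_pos.2 hρ) ?_ inter_subset_left hfin _ ?_
      · intro x
        have hx := hL x
        constructor
        · rintro ⟨hx1, hx2⟩
          have hx2 := (hP x).1 hx2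
          refine ⟨hx2, ?_⟩
          rw [mem_sphere.1 hx1, hx2] at hx
          rw [hx, add_sub_cancel_left, Real.sqrt_sq (norm_nonneg _)]
        · rintro ⟨hx1, hx2⟩
          refine ⟨?_, (hP x).2 hx1⟩
          rw [hx1, hx2, Real.sq_sqrt hρ.le, add_sub_cancel] at hx
          exact (pow_left_inj₀ dist_nonneg hR.le two_ne_zero).1 hx
      · have := hfin.cast_ncard_eq
        rw [← this] at hcard
        exact_mod_cast hcard

lemma rank_bound (c : E3) (R : ℝ) (hR : 0 < R) {k : ℕ} (P : Fin k → AffineSubspace ℝ E3)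
    (hdim : ∀ i, Module.finrank ℝ (P i).direction = 2)
    (hdist : ∀ i, Metric.infDist c (P i : Set E3) < R) (s : Finset (Fin k)) :
    Module.rank ℝ (LocallyConstant ↥(sphere c R \ ⋃ i ∈ s, (P i : Set E3)) ℝ) ≤
      ((if s.card = 0 then 1 else s.card ^ 2 - s.card + 2 : ℕ) : Cardinal) := by
  induction s using Finset.induction_on with
  | empty =>
    have : PreconnectedSpace ↥(sphere c R \ ⋃ i ∈ (∅ : Finset (Fin k)), (P i : Set E3)) := by
      apply Subtype.preconnectedSpace
      have := isPreconnected_sphere (E := E3) (by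
        rw [← Module.finrank_eq_rank]; simp) c R
      simpa using this
    simpa using rank_lc_le_one (X := ↥(sphere c R \ ⋃ i ∈ (∅ : Finset (Fin k)), (P i : Set E3)))
  | insert a s ha ih =>
    refine (step c R hR P hdim hdist s a).trans ((add_le_add ih le_rfl).trans ?_)
    rw [Finset.card_insert_of_notMem ha]
    norm_cast
    generalize s.card = n
    rcases n with _ | n
    · simp
    · simp only [Nat.add_eq_zero_iff, one_ne_zero, and_false, if_false]
      have e1 : (n + 1) ^ 2 - (n + 1) = n * n + n := by
        rw [Nat.sub_eq_iff_eq_add (by nlinarith)]; ring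
      have e2 : (n + 1 + 1) ^ 2 - (n + 1 + 1) = n * n + 3 * n + 2 := by
        rw [Nat.sub_eq_iff_eq_add (by nlinarith)]; ring
      rw [e1, e2, max_eq_right (by omega)]
      omega

/-- If `C_1, …, C_k` are round circles on a round sphere `S` in `ℝ³`
(each cut out by a plane whose distance to the center is less than the radius), then
`S` minus the circles has at most `k² - k + 2` connected components. -/
theorem sphere_minus_circles_components_le
    (c : EuclideanSpace ℝ (Fin 3)) (R : ℝ) (hR : 0 < R)
    (k : ℕ) (P : Fin k → AffineSubspace ℝ (EuclideanSpace ℝ (Fin 3)))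
    (hdim : ∀ i, Module.finrank ℝ (P i).direction = 2)
    (hdist : ∀ i, Metric.infDist c (P i : Set (EuclideanSpace ℝ (Fin 3))) < R) :
    Cardinal.mk
      (ConnectedComponents
        ↥(Metric.sphere c R \
            ⋃ i, (Metric.sphere c R ∩ (P i : Set (EuclideanSpace ℝ (Fin 3)))))) ≤
      ((k ^ 2 - k + 2 : ℕ) : Cardinal) := by
  have hset : Metric.sphere c R \
            ⋃ i, (Metric.sphere c R ∩ (P i : Set (EuclideanSpace ℝ (Fin 3)))) =
      Metric.sphere c R \ ⋃ i ∈ (Finset.univ : Finset (Fin k)), (P i : Set E3) := by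
    ext x
    simp only [mem_sdiff, mem_iUnion, mem_inter_iff, Finset.mem_univ, exists_true_left, not_exists]
    constructor
    · exact fun h => ⟨h.1, fun i hi => h.2 i ⟨h.1, hi⟩⟩
    · exact fun h => ⟨h.1, fun i hi => h.2 i hi.2⟩
  rw [hset]
  have hK : IsClosed (⋃ i ∈ (Finset.univ : Finset (Fin k)), (P i : Set E3)) :=
    Finset.univ.finite_toSet.isClosed_biUnion fun i _ => (P i).closed_of_finiteDimensional
  have := lcs_sphere c R hR
  have : LocallyConnectedSpace
      ↥(Metric.sphere c R \ ⋃ i ∈ (Finset.univ : Finset (Fin k)), (P i : Set E3)) := by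
    have hemb : IsOpenEmbedding (Set.inclusion (sdiff_subset :
        (Metric.sphere c R \ ⋃ i ∈ (Finset.univ : Finset (Fin k)), (P i : Set E3)) ⊆ _)) := by
      refine ⟨IsEmbedding.inclusion _, ?_⟩
      have : range (Set.inclusion (sdiff_subset :
        (Metric.sphere c R \ ⋃ i ∈ (Finset.univ : Finset (Fin k)), (P i : Set E3)) ⊆ _)) =
          (↑) ⁻¹' (⋃ i ∈ (Finset.univ : Finset (Fin k)), (P i : Set E3))ᶜ := by
        rw [Set.range_inclusion]
        ext x
        exact ⟨fun h => h.2, fun h => ⟨x.2, h⟩⟩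
      rw [this]
      exact hK.isOpen_compl.preimage continuous_subtype_val
    exact hemb.locallyConnectedSpace
  refine card_cc_le.trans ((rank_bound c R hR P hdim hdist Finset.univ).trans ?_)
  rw [Finset.card_univ, Fintype.card_fin]
  norm_cast
  split_ifs <;> omega
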